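/- arXiv:1604.02080 — 3 statements merged into one kernel-verified Lean document; each statement's English description precedes it below -/
import Mathlib

section
/- Suppose l ≤ R(s,a,s') ≤ u for all s, a, s', set η = max(|u|, |l|), and let F₀ : S → ℝ be the zero function. Then for every natural number i, sup_{s∈S} |F*(s) − (B^i F₀)(s)| ≤ γ^i · η/(1−γ), where F* is the unique bounded fixed point of B. -/
open MeasureTheory

section EntropicValue

variable {A Θ : Type*} [Fintype A] [MeasurableSpace Θ]

/-- The nested certainty equivalent of the payoffs `x a θ`: an exponential one of parameter `β`
over `θ`, followed by one of parameter `α` over `a`. -/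
noncomputable def entropicValue (ρ : A → ℝ) (μ : A → Measure Θ) (α β : ℝ) (x : A → Θ → ℝ) : ℝ :=
  (1 / α) * Real.log (∑ a, ρ a * (∫ θ, Real.exp (β * x a θ) ∂(μ a)) ^ (α / β))

variable {ρ : A → ℝ} {μ : A → Measure Θ} [∀ a, IsProbabilityMeasure (μ a)] {α β c : ℝ}

theorem entropicValue_zero (hρ : ∑ a, ρ a = 1) :
    entropicValue ρ μ α β (fun _ _ => 0) = 0 := by
  simp [entropicValue, hρ]

theorem integral_exp_rpow_le {ν : Measure Θ} [IsProbabilityMeasure ν] (hα : 0 < α) (hβ : β ≠ 0)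
    {x y : Θ → ℝ} (hx : Integrable (fun θ => Real.exp (β * x θ)) ν)
    (hy : Integrable (fun θ => Real.exp (β * y θ)) ν) (hxy : ∀ θ, x θ ≤ y θ + c) :
    (∫ θ, Real.exp (β * x θ) ∂ν) ^ (α / β) ≤
      Real.exp (α * c) * (∫ θ, Real.exp (β * y θ) ∂ν) ^ (α / β) := by
  have hxpos := integral_exp_pos hx
  have hypos := integral_exp_pos hy
  have hsplit : Real.exp (α * c) * (∫ θ, Real.exp (β * y θ) ∂ν) ^ (α / β) =
      (∫ θ, Real.exp (β * c) * Real.exp (β * y θ) ∂ν) ^ (α / β) := by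
    rw [integral_const_mul, Real.mul_rpow (Real.exp_pos _).le hypos.le, ← Real.exp_mul]
    congr 2
    field_simp
  have hy' : Integrable (fun θ => Real.exp (β * c) * Real.exp (β * y θ)) ν := hy.const_mul _
  rw [hsplit]
  rcases hβ.lt_or_gt with hneg | hpos
  · refine Real.rpow_le_rpow_of_nonpos ?_ (integral_mono hy' hx fun θ => ?_)
      (div_neg_of_pos_of_neg hα hneg).le
    · rw [integral_const_mul]
      positivity
    · simp only [← Real.exp_add]
      exact Real.exp_le_exp.2 (by nlinarith [hxy θ])
  · refine Real.rpow_le_rpow hxpos.le (integral_mono hx hy' fun θ => ?_) (by positivity)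
    simp only [← Real.exp_add]
    exact Real.exp_le_exp.2 (by nlinarith [hxy θ])

theorem entropicValue_le_add [Nonempty A] (hρ : ∀ a, 0 < ρ a) (hα : 0 < α) (hβ : β ≠ 0)
    {x y : A → Θ → ℝ} (hx : ∀ a, Integrable (fun θ => Real.exp (β * x a θ)) (μ a))
    (hy : ∀ a, Integrable (fun θ => Real.exp (β * y a θ)) (μ a))
    (hxy : ∀ a θ, x a θ ≤ y a θ + c) :
    entropicValue ρ μ α β x ≤ entropicValue ρ μ α β y + c := by
  have hsum : ∀ z : A → Θ → ℝ, (∀ a, Integrable (fun θ => Real.exp (β * z a θ)) (μ a)) →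
      0 < ∑ a, ρ a * (∫ θ, Real.exp (β * z a θ) ∂(μ a)) ^ (α / β) := fun z hz =>
    Finset.sum_pos (fun a _ => mul_pos (hρ a) (Real.rpow_pos_of_pos (integral_exp_pos (hz a)) _))
      Finset.univ_nonempty
  have hle : ∑ a, ρ a * (∫ θ, Real.exp (β * x a θ) ∂(μ a)) ^ (α / β) ≤
      Real.exp (α * c) * ∑ a, ρ a * (∫ θ, Real.exp (β * y a θ) ∂(μ a)) ^ (α / β) := by
    rw [Finset.mul_sum]
    refine Finset.sum_le_sum fun a _ => ?_
    rw [mul_left_comm]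
    exact mul_le_mul_of_nonneg_left (integral_exp_rpow_le hα hβ (hx a) (hy a) (hxy a)) (hρ a).le
  have hlog := Real.log_le_log (hsum x hx) hle
  rw [Real.log_mul (Real.exp_pos _).ne' (hsum y hy).ne', Real.log_exp] at hlog
  unfold entropicValue
  calc _ ≤ 1 / α * (α * c + _) := mul_le_mul_of_nonneg_left hlog (by positivity)
    _ = _ := by field_simp; ring

theorem abs_entropicValue_sub_le [Nonempty A] (hρ : ∀ a, 0 < ρ a) (hα : 0 < α) (hβ : β ≠ 0)
    {x y : A → Θ → ℝ} (hx : ∀ a, Integrable (fun θ => Real.exp (β * x a θ)) (μ a))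
    (hy : ∀ a, Integrable (fun θ => Real.exp (β * y a θ)) (μ a))
    (hxy : ∀ a θ, |x a θ - y a θ| ≤ c) :
    |entropicValue ρ μ α β x - entropicValue ρ μ α β y| ≤ c := by
  have h₁ := entropicValue_le_add hρ hα hβ hx hy (c := c)
    fun a θ => by linarith [(abs_le.1 (hxy a θ)).2]
  have h₂ := entropicValue_le_add hρ hα hβ hy hx (c := c)
    fun a θ => by linarith [(abs_le.1 (hxy a θ)).1]
  exact abs_le.2 ⟨by linarith, by linarith⟩

end EntropicValue

theorem abs_sum_mul_le_of_sum_eq_one {ι : Type*} [Fintype ι] {p v : ι → ℝ} {c : ℝ}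
    (hp : ∀ i, 0 ≤ p i) (hsum : ∑ i, p i = 1) (hv : ∀ i, |v i| ≤ c) : |∑ i, p i * v i| ≤ c :=
  calc |∑ i, p i * v i| ≤ ∑ i, |p i * v i| := Finset.abs_sum_le_sum_abs _ _
    _ ≤ ∑ i, p i * c := Finset.sum_le_sum fun i _ => by
        rw [abs_mul, abs_of_nonneg (hp i)]
        exact mul_le_mul_of_nonneg_left (hv i) (hp i)
    _ = c := by rw [← Finset.sum_mul, hsum, one_mul]

theorem integrable_exp_mul_sum {Θ ι : Type*} [MeasurableSpace Θ] [Fintype ι] {ν : Measure Θ}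
    [IsFiniteMeasure ν] {p : Θ → ι → ℝ} (hp : ∀ θ i, 0 ≤ p θ i) (hsum : ∀ θ, ∑ i, p θ i = 1)
    (hmeas : ∀ i, Measurable fun θ => p θ i) (β : ℝ) (v : ι → ℝ) :
    Integrable (fun θ => Real.exp (β * ∑ i, p θ i * v i)) ν := by
  refine Integrable.of_bound (C := Real.exp (|β| * ∑ i, |v i|))
    (by fun_prop) (Filter.Eventually.of_forall fun θ => ?_)
  rw [Real.norm_eq_abs, Real.abs_exp, Real.exp_le_exp]
  refine (le_abs_self _).trans ?_
  rw [abs_mul]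
  exact mul_le_mul_of_nonneg_left (abs_sum_mul_le_of_sum_eq_one (hp θ) (hsum θ) fun i =>
    Finset.single_le_sum (f := fun j => |v j|) (fun j _ => abs_nonneg _) (Finset.mem_univ i))
    (abs_nonneg _)

/-- If `l ≤ R s a s' ≤ u`, `η = max |u| |l|` and F₀ is the zero function, then
for every natural number i, `⨆ s, |F* s − (B^[i] F₀) s| ≤ γ^i * η / (1 - γ)`, where F* is the
unique (bounded) fixed point of the generalized Bellman operator B. -/
theorem stmt15 {S A : Type*} [Fintype S] [Nonempty S] [Fintype A] [Nonempty A]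
    {Θ : Type*} [MeasurableSpace Θ]
    (ρ : S → A → ℝ) (hρpos : ∀ s a, 0 < ρ s a) (hρsum : ∀ s, ∑ a, ρ s a = 1)
    (μ : A → S → Measure Θ) (hμ : ∀ a s, IsProbabilityMeasure (μ a s))
    (Tθ : Θ → A → S → S → ℝ)
    (hT0 : ∀ θ a s s', 0 ≤ Tθ θ a s s') (hT1 : ∀ θ a s, ∑ s', Tθ θ a s s' = 1)
    (hTmeas : ∀ a s s', Measurable (fun θ => Tθ θ a s s'))
    (R : S → A → S → ℝ) (l u : ℝ) (hRl : ∀ s a s', l ≤ R s a s') (hRu : ∀ s a s', R s a s' ≤ u)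
    (η : ℝ) (hη : η = max |u| |l|)
    (α : ℝ) (hα : 0 < α) (β : ℝ) (hβ : β ≠ 0)
    (γ : ℝ) (hγ0 : 0 < γ) (hγ1 : γ < 1)
    (B : (S → ℝ) → (S → ℝ))
    (hB : ∀ F s, B F s = (1/α) * Real.log (∑ a, ρ s a *
      (∫ θ, Real.exp (β * ∑ s', Tθ θ a s s' * (R s a s' + γ * F s')) ∂(μ a s)) ^ (α/β)))
    (Fstar : S → ℝ) (hfix : B Fstar = Fstar)
    (F₀ : S → ℝ) (hF₀ : F₀ = fun _ => 0) :
    ∀ i : ℕ, (⨆ s, |Fstar s - B^[i] F₀ s|) ≤ γ ^ i * η / (1 - γ) := by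
  have hR : ∀ s a s', |R s a s'| ≤ η := fun s a s' => by
    rw [hη]
    exact (abs_le_max_abs_abs (hRl s a s') (hRu s a s')).trans_eq (max_comm _ _)
  have hval : ∀ F s, B F s = entropicValue (ρ s) (fun a => μ a s) α β
      fun a θ => ∑ s', Tθ θ a s s' * (R s a s' + γ * F s') := hB
  have hint : ∀ (F : S → ℝ) s a, Integrable
      (fun θ => Real.exp (β * ∑ s', Tθ θ a s s' * (R s a s' + γ * F s'))) (μ a s) :=
    fun F s a => integrable_exp_mul_sum (fun θ => hT0 θ a s) (fun θ => hT1 θ a s)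
      (hTmeas a s) β _
  have hcontr : ∀ F G c, (∀ s, |F s - G s| ≤ c) → ∀ s, |B F s - B G s| ≤ γ * c := by
    intro F G c hFG s
    rw [hval, hval]
    refine abs_entropicValue_sub_le (hρpos s) hα hβ (hint F s) (hint G s) fun a θ => ?_
    rw [← Finset.sum_sub_distrib]
    simp only [← mul_sub, add_sub_add_left_eq_sub]
    refine abs_sum_mul_le_of_sum_eq_one (hT0 θ a s) (hT1 θ a s) fun s' => ?_
    rw [abs_mul, abs_of_pos hγ0]
    exact mul_le_mul_of_nonneg_left (hFG s') hγ0.le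
  have hgrowth : ∀ F c, (∀ s, |F s| ≤ c) → ∀ s, |B F s| ≤ η + γ * c := by
    intro F c hF s
    rw [hval, ← sub_zero (entropicValue _ _ _ _ _),
      ← entropicValue_zero (μ := fun a => μ a s) (α := α) (β := β) (hρsum s)]
    refine abs_entropicValue_sub_le (hρpos s) hα hβ (hint F s) (fun a => by simp) fun a θ => ?_
    rw [sub_zero]
    refine abs_sum_mul_le_of_sum_eq_one (hT0 θ a s) (hT1 θ a s) fun s' => ?_
    refine (abs_add_le _ _).trans (add_le_add (hR s a s') ?_)
    rw [abs_mul, abs_of_pos hγ0]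
    exact mul_le_mul_of_nonneg_left (hF s') hγ0.le
  have hstar : ∀ s, |Fstar s| ≤ η / (1 - γ) := by
    obtain ⟨s₀, hs₀⟩ := Finite.exists_max fun s => |Fstar s|
    have h := hgrowth Fstar _ hs₀ s₀
    rw [hfix] at h
    refine fun s => (hs₀ s).trans ?_
    rw [le_div_iff₀ (by linarith)]
    linarith
  have hiter : ∀ i s, |Fstar s - B^[i] F₀ s| ≤ γ ^ i * (η / (1 - γ)) := by
    intro i
    induction i with
    | zero => simpa [hF₀] using hstar
    | succ i ih =>
      intro s
      have h := hcontr Fstar (B^[i] F₀) _ ih s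
      rwa [hfix, ← Function.iterate_succ_apply' B, ← mul_assoc, ← pow_succ'] at h
  intro i
  rw [mul_div_assoc]
  exact ciSup_le (hiter i)
end

section
/- Suppose l ≤ R(s,a,s') ≤ u for all s, a, s', set η = max(|u|, |l|) with η > 0, and let ε be a real number with 0 < ε < η/(1−γ). If the value iteration from the zero initial function F₀ = 0 is run for i = ⌈ log(ε·(1−γ)/η) / log γ ⌉ iterations, then sup_{s∈S} |F*(s) − (B^i F₀)(s)| ≤ ε, where F* is the unique bounded fixed point of B. -/
open MeasureTheory

/-- Shifting the exponent by at most `c` scales the `α/β`-power of the exponential moment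
by at most `exp (α * c)`, whatever the sign of `β`. -/
theorem rpow_integral_exp_le {Θ : Type*} [MeasurableSpace Θ] {μ : Measure Θ}
    [IsProbabilityMeasure μ] {X Y : Θ → ℝ} {α β c : ℝ} (hα : 0 < α) (hβ : β ≠ 0)
    (hX : Integrable (fun θ => Real.exp (β * X θ)) μ)
    (hY : Integrable (fun θ => Real.exp (β * Y θ)) μ) (h : ∀ θ, X θ ≤ Y θ + c) :
    (∫ θ, Real.exp (β * X θ) ∂μ) ^ (α / β) ≤
      Real.exp (α * c) * (∫ θ, Real.exp (β * Y θ) ∂μ) ^ (α / β) := by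
  have hXpos := integral_exp_pos hX
  have hYpos := integral_exp_pos hY
  have hscale : Real.exp (α * c) * (∫ θ, Real.exp (β * Y θ) ∂μ) ^ (α / β) =
      (Real.exp (β * c) * ∫ θ, Real.exp (β * Y θ) ∂μ) ^ (α / β) := by
    rw [Real.mul_rpow (Real.exp_pos _).le hYpos.le, ← Real.exp_mul]
    congr 2
    field_simp
  rw [hscale]
  rcases lt_or_gt_of_ne hβ with hneg | hpos
  · refine Real.rpow_le_rpow_of_nonpos (by positivity) ?_
      (div_nonpos_of_nonneg_of_nonpos hα.le hneg.le)
    rw [← integral_const_mul]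
    refine integral_mono (hY.const_mul _) hX fun θ => ?_
    simp only [← Real.exp_add]
    exact Real.exp_le_exp.2 (by nlinarith [h θ])
  · refine Real.rpow_le_rpow hXpos.le ?_ (by positivity)
    rw [← integral_const_mul]
    refine integral_mono hX (hY.const_mul _) fun θ => ?_
    simp only [← Real.exp_add]
    exact Real.exp_le_exp.2 (by nlinarith [h θ])

/-- The nested log-exponential mean is monotone up to additive constants. -/
theorem log_sum_rpow_integral_exp_le {A : Type*} [Fintype A] [Nonempty A]
    {Θ : Type*} [MeasurableSpace Θ] {ρ : A → ℝ} (hρ : ∀ a, 0 < ρ a)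
    {μ : A → Measure Θ} [∀ a, IsProbabilityMeasure (μ a)] {X Y : A → Θ → ℝ} {α β c : ℝ}
    (hα : 0 < α) (hβ : β ≠ 0)
    (hX : ∀ a, Integrable (fun θ => Real.exp (β * X a θ)) (μ a))
    (hY : ∀ a, Integrable (fun θ => Real.exp (β * Y a θ)) (μ a))
    (h : ∀ a θ, X a θ ≤ Y a θ + c) :
    (1 / α) * Real.log (∑ a, ρ a * (∫ θ, Real.exp (β * X a θ) ∂(μ a)) ^ (α / β)) ≤
      (1 / α) * Real.log (∑ a, ρ a * (∫ θ, Real.exp (β * Y a θ) ∂(μ a)) ^ (α / β)) + c := by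
  have pos {Z : A → Θ → ℝ} (hZ : ∀ a, Integrable (fun θ => Real.exp (β * Z a θ)) (μ a)) :
      0 < ∑ a, ρ a * (∫ θ, Real.exp (β * Z a θ) ∂(μ a)) ^ (α / β) :=
    Finset.sum_pos (fun a _ => mul_pos (hρ a) (Real.rpow_pos_of_pos (integral_exp_pos (hZ a)) _))
      Finset.univ_nonempty
  have hsum : ∑ a, ρ a * (∫ θ, Real.exp (β * X a θ) ∂(μ a)) ^ (α / β) ≤
      Real.exp (α * c) * ∑ a, ρ a * (∫ θ, Real.exp (β * Y a θ) ∂(μ a)) ^ (α / β) := by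
    rw [Finset.mul_sum]
    refine Finset.sum_le_sum fun a _ => ?_
    rw [mul_left_comm]
    exact mul_le_mul_of_nonneg_left (rpow_integral_exp_le hα hβ (hX a) (hY a) (h a)) (hρ a).le
  have hlog := Real.log_le_log (pos hX) hsum
  rw [Real.log_mul (Real.exp_pos _).ne' (pos hY).ne', Real.log_exp] at hlog
  have := mul_le_mul_of_nonneg_left hlog (one_div_pos.2 hα).le
  rw [mul_add, ← mul_assoc, one_div_mul_cancel hα.ne', one_mul] at this
  linarith

/-- Averages of a finite function under measurable random weights have exponential moments. -/
theorem integrable_exp_mul_sum_s16 {S Θ : Type*} [Fintype S] [MeasurableSpace Θ] {μ : Measure Θ}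
    [IsFiniteMeasure μ] {T : Θ → S → ℝ} (hT0 : ∀ θ s, 0 ≤ T θ s) (hT1 : ∀ θ, ∑ s, T θ s = 1)
    (hT : ∀ s, Measurable fun θ => T θ s) (β : ℝ) (f : S → ℝ) :
    Integrable (fun θ => Real.exp (β * ∑ s, T θ s * f s)) μ := by
  have hmeas : Measurable fun θ => Real.exp (β * ∑ s, T θ s * f s) := by fun_prop
  refine .of_bound hmeas.aestronglyMeasurable (Real.exp (|β| * ∑ s, |f s|)) (.of_forall fun θ => ?_)
  rw [Real.norm_eq_abs, Real.abs_exp]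
  refine Real.exp_le_exp.2 ((le_abs_self _).trans ?_)
  rw [abs_mul]
  refine mul_le_mul_of_nonneg_left ((Finset.abs_sum_le_sum_abs _ _).trans ?_) (abs_nonneg _)
  refine Finset.sum_le_sum fun s _ => ?_
  rw [abs_mul, abs_of_nonneg (hT0 θ s)]
  have : T θ s ≤ 1 := hT1 θ ▸ Finset.single_le_sum (fun s _ => hT0 θ s) (Finset.mem_univ s)
  exact mul_le_of_le_one_left (abs_nonneg _) this

/-- Weighted averages of functions differing by at most `c` differ by at most `c`. -/
theorem sum_mul_le_sum_mul_add {S : Type*} [Fintype S] {w f g : S → ℝ} {c : ℝ}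
    (hw0 : ∀ s, 0 ≤ w s) (hw1 : ∑ s, w s = 1) (h : ∀ s, f s ≤ g s + c) :
    ∑ s, w s * f s ≤ ∑ s, w s * g s + c := by
  calc ∑ s, w s * f s ≤ ∑ s, w s * (g s + c) :=
        Finset.sum_le_sum fun s _ => mul_le_mul_of_nonneg_left (h s) (hw0 s)
    _ = ∑ s, w s * g s + c := by
        simp only [mul_add, Finset.sum_add_distrib, ← Finset.sum_mul, hw1, one_mul]

/-- The number of iterations after which a `γ`-contraction started at distance `η / (1 - γ)`
is `ε`-accurate. -/
theorem pow_ceil_log_div_log_mul_le {γ η ε : ℝ} (hγ0 : 0 < γ) (hγ1 : γ < 1) (hη : 0 < η)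
    (hε : 0 < ε) :
    γ ^ ⌈Real.log (ε * (1 - γ) / η) / Real.log γ⌉₊ * (η / (1 - γ)) ≤ ε := by
  have h1γ : 0 < 1 - γ := sub_pos.2 hγ1
  have hx : 0 < ε * (1 - γ) / η := by positivity
  have hpow : γ ^ ⌈Real.log (ε * (1 - γ) / η) / Real.log γ⌉₊ ≤ ε * (1 - γ) / η := by
    rw [← Real.log_le_log_iff (pow_pos hγ0 _) hx, Real.log_pow]
    exact (div_le_iff_of_neg (Real.log_neg hγ0 hγ1)).1 (Nat.le_ceil _)
  calc _ ≤ ε * (1 - γ) / η * (η / (1 - γ)) := by gcongr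
    _ = ε := by field_simp

/-- If `l ≤ R s a s' ≤ u`, `η = max |u| |l| > 0`, and `0 < ε < η/(1-γ)`, then
running value iteration from the zero function F₀ for
`i = ⌈ log (ε·(1-γ)/η) / log γ ⌉` iterations yields
`⨆ s, |F* s − (B^[i] F₀) s| ≤ ε`, where F* is the unique (bounded) fixed point of B. -/
theorem stmt16 {S A : Type*} [Fintype S] [Nonempty S] [Fintype A] [Nonempty A]
    {Θ : Type*} [MeasurableSpace Θ]
    (ρ : S → A → ℝ) (hρpos : ∀ s a, 0 < ρ s a) (hρsum : ∀ s, ∑ a, ρ s a = 1)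
    (μ : A → S → Measure Θ) (hμ : ∀ a s, IsProbabilityMeasure (μ a s))
    (Tθ : Θ → A → S → S → ℝ)
    (hT0 : ∀ θ a s s', 0 ≤ Tθ θ a s s') (hT1 : ∀ θ a s, ∑ s', Tθ θ a s s' = 1)
    (hTmeas : ∀ a s s', Measurable (fun θ => Tθ θ a s s'))
    (R : S → A → S → ℝ) (l u : ℝ) (hRl : ∀ s a s', l ≤ R s a s') (hRu : ∀ s a s', R s a s' ≤ u)
    (η : ℝ) (hη : η = max |u| |l|) (hηpos : 0 < η)
    (α : ℝ) (hα : 0 < α) (β : ℝ) (hβ : β ≠ 0)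
    (γ : ℝ) (hγ0 : 0 < γ) (hγ1 : γ < 1)
    (B : (S → ℝ) → (S → ℝ))
    (hB : ∀ F s, B F s = (1/α) * Real.log (∑ a, ρ s a *
      (∫ θ, Real.exp (β * ∑ s', Tθ θ a s s' * (R s a s' + γ * F s')) ∂(μ a s)) ^ (α/β)))
    (Fstar : S → ℝ) (hfix : B Fstar = Fstar)
    (F₀ : S → ℝ) (hF₀ : F₀ = fun _ => 0)
    (ε : ℝ) (hε0 : 0 < ε) (hε1 : ε < η / (1 - γ))
    (i : ℕ) (hi : i = ⌈Real.log (ε * (1 - γ) / η) / Real.log γ⌉₊) :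
    (⨆ s, |Fstar s - B^[i] F₀ s|) ≤ ε := by
  have key (s : S) (f g : A → S → ℝ) (c : ℝ) (h : ∀ a s', f a s' ≤ g a s' + c) :
      (1 / α) * Real.log (∑ a, ρ s a *
        (∫ θ, Real.exp (β * ∑ s', Tθ θ a s s' * f a s') ∂(μ a s)) ^ (α / β)) ≤
      (1 / α) * Real.log (∑ a, ρ s a *
        (∫ θ, Real.exp (β * ∑ s', Tθ θ a s s' * g a s') ∂(μ a s)) ^ (α / β)) + c :=
    have (a : A) := hμ a s
    log_sum_rpow_integral_exp_le (hρpos s) hα hβ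
      (fun a => integrable_exp_mul_sum_s16 (hT0 · a s) (hT1 · a s) (hTmeas a s) β (f a))
      (fun a => integrable_exp_mul_sum_s16 (hT0 · a s) (hT1 · a s) (hTmeas a s) β (g a))
      (fun a θ => sum_mul_le_sum_mul_add (hT0 θ a s) (hT1 θ a s) (h a))
  have hzero (s : S) : (1 / α) * Real.log (∑ a, ρ s a *
      (∫ θ, Real.exp (β * ∑ s', Tθ θ a s s' * (0 : ℝ)) ∂(μ a s)) ^ (α / β)) = 0 := by
    have (a : A) := hμ a s
    simp [hρsum]
  have hcontr (F G : S → ℝ) (c : ℝ) (h : ∀ s, |F s - G s| ≤ c) (s : S) :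
      |B F s - B G s| ≤ γ * c := by
    rw [hB, hB, abs_sub_le_iff]
    constructor
    · rw [sub_le_iff_le_add']
      refine key s _ _ _ fun a s' => ?_
      nlinarith [(abs_sub_le_iff.1 (h s')).1]
    · rw [sub_le_iff_le_add']
      refine key s _ _ _ fun a s' => ?_
      nlinarith [(abs_sub_le_iff.1 (h s')).2]
  have hR (s : S) (a : A) (s' : S) : |R s a s'| ≤ η := by
    rw [hη, max_comm]
    exact abs_le_max_abs_abs (hRl s a s') (hRu s a s')
  have hbound (F : S → ℝ) (M : ℝ) (h : ∀ s, |F s| ≤ M) (s : S) : |B F s| ≤ η + γ * M := by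
    rw [hB, abs_le]
    constructor
    · have := key s (fun _ _ => 0) (fun a s' => R s a s' + γ * F s') (η + γ * M) fun a s' => by
        nlinarith [(abs_le.1 (hR s a s')).1, (abs_le.1 (h s')).1]
      rw [hzero] at this
      linarith
    · have := key s (fun a s' => R s a s' + γ * F s') (fun _ _ => 0) (η + γ * M) fun a s' => by
        nlinarith [(abs_le.1 (hR s a s')).2, (abs_le.1 (h s')).2]
      rwa [hzero, zero_add] at this
  have hFstar (s : S) : |Fstar s| ≤ η / (1 - γ) := by
    obtain ⟨s₀, hs₀⟩ := Finite.exists_max fun s => |Fstar s|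
    refine (hs₀ s).trans ?_
    have := hbound Fstar _ hs₀ s₀
    rw [hfix] at this
    rw [le_div_iff₀ (sub_pos.2 hγ1)]
    linarith
  have hiter (n : ℕ) : ∀ s, |Fstar s - B^[n] F₀ s| ≤ γ ^ n * (η / (1 - γ)) := by
    induction n with
    | zero => simpa [hF₀] using hFstar
    | succ n ih =>
      intro s
      have := hcontr _ _ _ ih s
      rwa [hfix, ← Function.iterate_succ_apply' B, ← mul_assoc, ← pow_succ'] at this
  refine ciSup_le fun s => (hiter i s).trans ?_
  rw [hi]
  exact pow_ceil_log_div_log_mul_le hγ0 hγ1 hηpos hε0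
end

section
/- Let β > 0. Suppose there exists a policy-belief pair (π*, ψ*) whose free-energy vector dominates all others, i.e. F_{π*,ψ*}(s) ≥ F_{π,ψ}(s) for every admissible pair (π, ψ) and every s ∈ S, and set F* = F_{π*,ψ*}. Suppose moreover that for the operator (B F)(s) = sup_{(π,ψ)} (T_{π,ψ} F)(s) there exists an admissible pair (π', ψ') attaining (B F*)(s) = (T_{π',ψ'} F*)(s) for all s. Then F* = B F*; and F* is the unique such fixed point: if F' = F_{π'',ψ''} for some admissible pair (π'', ψ'') and F' = B F', then F' = F*. -/
open MeasureTheory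

/-- An order-preserving operator on `S → ℝ` that discounts constant shifts by `γ < 1`
satisfies a comparison principle between its sub- and supersolutions. -/
theorem le_of_discounted {S : Type*} [Fintype S] [Nonempty S] {γ : ℝ} (hγ1 : γ < 1)
    {T : (S → ℝ) → S → ℝ}
    (hT : ∀ F G c, (∀ s, F s ≤ G s + c) → ∀ s, T F s ≤ T G s + γ * c)
    {F G : S → ℝ} (hF : ∀ s, F s ≤ T F s) (hG : ∀ s, T G s ≤ G s) (s : S) : F s ≤ G s := by
  obtain ⟨m, hm⟩ := Finite.exists_max fun s => F s - G s
  have h := hT F G (F m - G m) (fun s => by linarith [hm s]) m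
  have hle : F m - G m ≤ 0 := by nlinarith [hF m, hG m]
  linarith [hm s]

/-- An order-preserving operator on `S → ℝ` that discounts constant shifts by `γ ∈ [0, 1)`
has a fixed point. -/
theorem exists_fixedPoint_of_discounted {S : Type*} [Fintype S] {γ : ℝ} (hγ0 : 0 ≤ γ)
    (hγ1 : γ < 1) {T : (S → ℝ) → S → ℝ}
    (hT : ∀ F G c, (∀ s, F s ≤ G s + c) → ∀ s, T F s ≤ T G s + γ * c) :
    ∃ F, T F = F := by
  have hshift : ∀ (F G : S → ℝ) (s : S), F s ≤ G s + dist F G := fun F G s => by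
    have := (le_abs_self _).trans (Real.dist_eq (F s) (G s) ▸ dist_le_pi_dist F G s)
    linarith
  have hc : ContractingWith ⟨γ, hγ0⟩ T := by
    refine ⟨by exact_mod_cast hγ1, LipschitzWith.of_dist_le_mul fun F G => ?_⟩
    refine (dist_pi_le_iff (by positivity)).2 fun s => ?_
    have h₁ := hT F G _ (hshift F G) s
    have h₂ := hT G F _ (hshift G F) s
    rw [dist_comm G F] at h₂
    rw [Real.dist_eq, abs_le]
    change -(γ * dist F G) ≤ _ ∧ _ ≤ γ * dist F G
    constructor <;> linarith
  exact ⟨_, hc.fixedPoint_isFixedPt⟩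

/-- The integrated log-likelihood ratio of two probability measures is nonnegative. -/
theorem integral_log_rnDeriv_nonneg {Θ : Type*} [MeasurableSpace Θ] {ν μ : Measure Θ}
    [IsProbabilityMeasure ν] [IsProbabilityMeasure μ] (hac : ν ≪ μ)
    (hint : Integrable (fun θ => Real.log ((ν.rnDeriv μ θ).toReal)) ν) :
    0 ≤ ∫ θ, Real.log ((ν.rnDeriv μ θ).toReal) ∂ν := by
  simpa [llr] using InformationTheory.integral_llr_add_sub_measure_univ_nonneg hac hint

/-- Pointwise lower bound behind the nonnegativity of relative entropy on a finite type. -/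
theorem sub_le_mul_log_div {x r : ℝ} (hx : 0 ≤ x) (hr : 0 < r) :
    x - r ≤ x * Real.log (x / r) := by
  rcases hx.eq_or_lt with rfl | hx
  · simpa using hr.le
  · have h := mul_le_mul_of_nonneg_left (Real.one_sub_inv_le_log_of_pos (div_pos hx hr)) hx.le
    have e : x * (1 - (x / r)⁻¹) = x - r := by field_simp
    linarith

/-- Averages of a function bounded by `C`, with nonnegative weights of total mass one. -/
theorem abs_sum_mul_le_of_sum_eq_one_s17 {ι : Type*} [Fintype ι] {w f : ι → ℝ} {C : ℝ}
    (hw : ∀ i, 0 ≤ w i) (hw1 : ∑ i, w i = 1) (hf : ∀ i, |f i| ≤ C) :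
    |∑ i, w i * f i| ≤ C := by
  calc |∑ i, w i * f i| ≤ ∑ i, |w i * f i| := Finset.abs_sum_le_sum_abs _ _
    _ ≤ ∑ i, w i * C := Finset.sum_le_sum fun i _ => by
        rw [abs_mul, abs_of_nonneg (hw i)]
        exact mul_le_mul_of_nonneg_left (hf i) (hw i)
    _ = C := by rw [← Finset.sum_mul, hw1, one_mul]

/-- β > 0: Suppose the admissible pair (π*, ψ*) has a free-energy vector
F* = F_{π*,ψ*} (fixed point of T_{π*,ψ*}) dominating the free-energy vector of every
admissible pair, and suppose the operator `(B F) s = sup_{(π,ψ)} (T_{π,ψ} F) s` is attained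
at F* by some admissible pair.  Then F* = B F*, and F* is the unique such fixed point: any
F' that is the free-energy vector of an admissible pair and satisfies F' = B F' equals F*. -/
theorem stmt17 {S A : Type*} [Fintype S] [Nonempty S] [Fintype A] [Nonempty A]
    {Θ : Type*} [MeasurableSpace Θ]
    (ρ : S → A → ℝ) (hρpos : ∀ s a, 0 < ρ s a) (hρsum : ∀ s, ∑ a, ρ s a = 1)
    (μ : A → S → Measure Θ) (hμ : ∀ a s, IsProbabilityMeasure (μ a s))
    (Tθ : Θ → A → S → S → ℝ)
    (hT0 : ∀ θ a s s', 0 ≤ Tθ θ a s s') (hT1 : ∀ θ a s, ∑ s', Tθ θ a s s' = 1)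
    (hTmeas : ∀ a s s', Measurable (fun θ => Tθ θ a s s'))
    (R : S → A → S → ℝ) (CR : ℝ) (hR : ∀ s a s', |R s a s'| ≤ CR)
    (α : ℝ) (hα : 0 < α) (β : ℝ) (hβ : 0 < β)
    (γ : ℝ) (hγ0 : 0 < γ) (hγ1 : γ < 1)
    -- policies and beliefs
    (Pol : (S → A → ℝ) → Prop)
    (hPol : ∀ π, Pol π ↔ ((∀ s a, 0 ≤ π s a) ∧ ∀ s, ∑ a, π s a = 1))
    (Bel : (A → S → Measure Θ) → Prop)
    (hBel : ∀ ψ, Bel ψ ↔ ∀ a s, IsProbabilityMeasure (ψ a s) ∧ ψ a s ≪ μ a s ∧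
      Integrable (fun θ => Real.log (((ψ a s).rnDeriv (μ a s) θ).toReal)) (ψ a s))
    -- the operator T_{π,ψ}
    (Top : (S → A → ℝ) → (A → S → Measure Θ) → (S → ℝ) → (S → ℝ))
    (hTop : ∀ π ψ F s, Top π ψ F s = ∑ a, π s a * ( -(1/α) * Real.log (π s a / ρ s a)
      + ∫ θ, ( -(1/β) * Real.log (((ψ a s).rnDeriv (μ a s) θ).toReal)
          + ∑ s', Tθ θ a s s' * (R s a s' + γ * F s') ) ∂(ψ a s) ))
    -- the operator (B F) s = sup over admissible pairs of (T_{π,ψ} F) s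
    (B : (S → ℝ) → (S → ℝ))
    (hB : ∀ F s, B F s = sSup {x : ℝ | ∃ π ψ, Pol π ∧ Bel ψ ∧ x = Top π ψ F s})
    -- the dominating admissible pair (π*, ψ*) with free-energy vector F*
    (πstar : S → A → ℝ) (ψstar : A → S → Measure Θ) (Fstar : S → ℝ)
    (hπstar : Pol πstar) (hψstar : Bel ψstar)
    (hfixstar : Top πstar ψstar Fstar = Fstar)
    (hdom : ∀ π ψ F, Pol π → Bel ψ → Top π ψ F = F → ∀ s, F s ≤ Fstar s)
    -- B F* is attained by some admissible pair
    (hattain : ∃ π' ψ', Pol π' ∧ Bel ψ' ∧ ∀ s, B Fstar s = Top π' ψ' Fstar s) :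
    Fstar = B Fstar ∧
    (∀ (π'' : S → A → ℝ) (ψ'' : A → S → Measure Θ) (F' : S → ℝ),
      Pol π'' → Bel ψ'' → Top π'' ψ'' F' = F' → F' = B F' → F' = Fstar) := by
  have hbound : ∀ F : S → ℝ, ∃ C, ∀ s a s', |R s a s' + γ * F s'| ≤ C := fun F =>
    ⟨CR + γ * ‖F‖, fun s a s' => (abs_add_le _ _).trans <| add_le_add (hR s a s') <| by
      rw [abs_mul, abs_of_pos hγ0]
      exact mul_le_mul_of_nonneg_left (norm_le_pi_norm F s') hγ0.le⟩
  have hintQ : ∀ ψ, Bel ψ → ∀ (F : S → ℝ) s a,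
      Integrable (fun θ => ∑ s', Tθ θ a s s' * (R s a s' + γ * F s')) (ψ a s) := by
    intro ψ hψ F s a
    have := ((hBel ψ).1 hψ a s).1
    obtain ⟨C, hC⟩ := hbound F
    refine Integrable.of_bound (Finset.measurable_sum _ fun s' _ =>
      (hTmeas a s s').mul_const _).aestronglyMeasurable C (ae_of_all _ fun θ => ?_)
    exact abs_sum_mul_le_of_sum_eq_one_s17 (hT0 θ a s) (hT1 θ a s) (hC s a)
  have hintL : ∀ ψ, Bel ψ → ∀ s a, Integrable
      (fun θ => -(1/β) * Real.log (((ψ a s).rnDeriv (μ a s) θ).toReal)) (ψ a s) :=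
    fun ψ hψ s a => ((hBel ψ).1 hψ a s).2.2.const_mul _
  have hdisc : ∀ π ψ, Pol π → Bel ψ → ∀ F G c, (∀ s, F s ≤ G s + c) →
      ∀ s, Top π ψ F s ≤ Top π ψ G s + γ * c := by
    intro π ψ hπ hψ F G c hFG s
    obtain ⟨hπ0, hπ1⟩ := (hPol π).1 hπ
    have hint : ∀ F : S → ℝ, ∀ a, Integrable (fun θ =>
        -(1/β) * Real.log (((ψ a s).rnDeriv (μ a s) θ).toReal)
          + ∑ s', Tθ θ a s s' * (R s a s' + γ * F s')) (ψ a s) :=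
      fun F a => (hintL ψ hψ s a).add (hintQ ψ hψ F s a)
    have hsumπ : γ * c = ∑ a, π s a * (γ * c) := by rw [← Finset.sum_mul, hπ1, one_mul]
    rw [hTop, hTop, hsumπ, ← Finset.sum_add_distrib]
    refine Finset.sum_le_sum fun a _ => ?_
    rw [← mul_add, add_assoc]
    refine mul_le_mul_of_nonneg_left (add_le_add le_rfl ?_) (hπ0 s a)
    have := ((hBel ψ).1 hψ a s).1
    have hconst : γ * c = ∫ _, γ * c ∂(ψ a s) := by simp
    rw [hconst, ← integral_add (hint G a) (integrable_const _)]
    refine integral_mono (hint F a) ((hint G a).add (integrable_const _)) fun θ => ?_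
    dsimp only
    rw [add_assoc]
    refine add_le_add le_rfl ?_
    have hsumT : γ * c = ∑ s', Tθ θ a s s' * (γ * c) := by
      rw [← Finset.sum_mul, hT1, one_mul]
    rw [hsumT, ← Finset.sum_add_distrib]
    refine Finset.sum_le_sum fun s' _ => ?_
    rw [← mul_add, add_assoc, ← mul_add]
    exact mul_le_mul_of_nonneg_left
      (add_le_add le_rfl (mul_le_mul_of_nonneg_left (hFG s') hγ0.le)) (hT0 θ a s s')
  have hle_B : ∀ π ψ, Pol π → Bel ψ → ∀ F s, Top π ψ F s ≤ B F s := by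
    intro π ψ hπ hψ F s
    rw [hB]
    refine le_csSup ?_ ⟨π, ψ, hπ, hψ, rfl⟩
    obtain ⟨C, hC⟩ := hbound F
    refine ⟨C, ?_⟩
    rintro _ ⟨π, ψ, hπ, hψ, rfl⟩
    obtain ⟨hπ0, hπ1⟩ := (hPol π).1 hπ
    have hterm : ∀ a, π s a * ( -(1/α) * Real.log (π s a / ρ s a)
        + ∫ θ, ( -(1/β) * Real.log (((ψ a s).rnDeriv (μ a s) θ).toReal)
          + ∑ s', Tθ θ a s s' * (R s a s' + γ * F s') ) ∂(ψ a s) )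
        ≤ -(1/α) * (π s a - ρ s a) + π s a * C := by
      intro a
      obtain ⟨hprob, hac, hint⟩ := (hBel ψ).1 hψ a s
      have := hμ a s
      have hKL := integral_log_rnDeriv_nonneg hac hint
      have hQ : ∫ θ, ∑ s', Tθ θ a s s' * (R s a s' + γ * F s') ∂(ψ a s) ≤ C := by
        refine (integral_mono (hintQ ψ hψ F s a) (integrable_const C) fun θ =>
          (le_abs_self _).trans
            (abs_sum_mul_le_of_sum_eq_one_s17 (hT0 θ a s) (hT1 θ a s) (hC s a))).trans ?_
        simp
      rw [integral_add (hintL ψ hψ s a) (hintQ ψ hψ F s a), integral_const_mul, mul_add]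
      have hinvβ : 0 ≤ 1 / β := by positivity
      have hinvα : 0 ≤ 1 / α := by positivity
      refine add_le_add ?_ (mul_le_mul_of_nonneg_left ?_ (hπ0 s a))
      · linarith [mul_le_mul_of_nonneg_left
          (sub_le_mul_log_div (hπ0 s a) (hρpos s a)) hinvα]
      · linarith [mul_nonneg hinvβ hKL]
    rw [hTop]
    refine (Finset.sum_le_sum fun a _ => hterm a).trans ?_
    rw [Finset.sum_add_distrib, ← Finset.mul_sum, Finset.sum_sub_distrib, ← Finset.sum_mul,
      hπ1, hρsum]
    simp
  have hsub : ∀ s, Fstar s ≤ B Fstar s := fun s =>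
    (congrFun hfixstar s).symm.le.trans (hle_B _ _ hπstar hψstar Fstar s)
  constructor
  · obtain ⟨π', ψ', hπ', hψ', hB'⟩ := hattain
    obtain ⟨F', hF'⟩ :=
      exists_fixedPoint_of_discounted hγ0.le hγ1 (hdisc π' ψ' hπ' hψ')
    have hle := le_of_discounted hγ1 (hdisc π' ψ' hπ' hψ')
      (fun s => (hsub s).trans_eq (hB' s)) fun s => (congrFun hF' s).le
    obtain rfl : F' = Fstar :=
      funext fun s => le_antisymm (hdom π' ψ' F' hπ' hψ' hF' s) (hle s)
    exact funext fun s => ((hB' s).trans (congrFun hF' s)).symm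
  · intro π'' ψ'' F' hπ'' hψ'' hF' hBF'
    refine funext fun s => le_antisymm (hdom π'' ψ'' F' hπ'' hψ'' hF' s) ?_
    exact le_of_discounted hγ1 (hdisc πstar ψstar hπstar hψstar)
      (fun s => (congrFun hfixstar s).symm.le)
      (fun s => (hle_B _ _ hπstar hψstar F' s).trans_eq (congrFun hBF' s).symm) s
end
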